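/- For infinitely many positive integers n, d(d(n)) > 4^{√(2 log n)/ log log n}. -/

import Mathlib

open Finset

/-- The number of divisors of a product of powers of distinct primes. -/
theorem card_divisors_prod_prime_pow {ι : Type*} (s : Finset ι) (q a : ι → ℕ)
    (hq : ∀ i ∈ s, (q i).Prime) (hinj : Set.InjOn q s) :
    (∏ i ∈ s, q i ^ a i).divisors.card = ∏ i ∈ s, (a i + 1) := by
  classical
  induction s using Finset.induction_on with
  | empty => simp
  | insert i s hi ih =>
    rw [prod_insert hi, prod_insert hi, Nat.Coprime.card_divisors_mul,
      ih (fun j hj => hq j (mem_insert_of_mem hj)) (hinj.mono (by simp)),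
      Nat.divisors_prime_pow (hq i (mem_insert_self i s))]
    · simp
    · refine Nat.Coprime.prod_right fun j hj => Nat.Coprime.pow _ _ ?_
      rw [Nat.coprime_primes (hq i (mem_insert_self i s)) (hq j (mem_insert_of_mem hj))]
      intro h
      have := hinj (by simp) (by simp [hj]) h
      exact hi (this ▸ hj)

/-- An integer whose number of divisors is a prescribed product of prime powers, built from
primes up to `z`. -/
theorem exists_card_divisors_eq_prod_pow (P : Finset ℕ) (hP : ∀ p ∈ P, p.Prime) (e : ℕ → ℕ)
    (z : ℕ) (hz : ∑ p ∈ P, e p ≤ Nat.primeCounting z) :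
    ∃ n : ℕ, n ≠ 0 ∧ n.divisors.card = ∏ p ∈ P, p ^ e p ∧
      Real.log n ≤ Real.log z * ∑ p ∈ P, (e p : ℝ) * ((p : ℝ) - 1) ∧
      Real.log 2 * ∑ p ∈ P, (e p : ℝ) * ((p : ℝ) - 1) ≤ Real.log n := by
  classical
  let s : Finset (Σ _ : ℕ, ℕ) := P.sigma fun p => range (e p)
  have hcard : s.card ≤ (Nat.primesLE z).card := by
    rw [Nat.primesLE_card_eq_primeCounting]
    simpa [s, card_sigma] using hz
  obtain ⟨q, hq, hinj⟩ : ∃ q : (Σ _ : ℕ, ℕ) → ℕ,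
      (∀ i ∈ s, q i ∈ Nat.primesLE z) ∧ Set.InjOn q s := by
    obtain ⟨t, ht, htc⟩ := exists_subset_card_eq hcard
    let f := Finset.equivOfCardEq htc.symm
    refine ⟨fun i => if h : i ∈ s then f ⟨i, h⟩ else 0, fun i hi => ?_, fun i hi j hj hij => ?_⟩
    · simp only [hi, dite_true]
      exact ht (f ⟨i, hi⟩).2
    · have hi' : i ∈ s := hi
      have hj' : j ∈ s := hj
      simp only [hi', hj', dite_true] at hij
      simpa using f.injective (Subtype.ext hij)
  have hqp : ∀ i ∈ s, (q i).Prime := fun i hi => Nat.prime_of_mem_primesLE (hq i hi)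
  have hsP : ∀ i ∈ s, i.1.Prime := fun i hi => hP _ (mem_sigma.1 hi).1
  have hsum : ∑ p ∈ P, (e p : ℝ) * ((p : ℝ) - 1) = ∑ i ∈ s, ((i.1 - 1 : ℕ) : ℝ) := by
    rw [sum_sigma]
    refine sum_congr rfl fun p hp => ?_
    simp only [sum_const, card_range, nsmul_eq_mul]
    rw [Nat.cast_sub (hP p hp).one_le, Nat.cast_one]
  have hlog : Real.log ((∏ i ∈ s, q i ^ (i.1 - 1) : ℕ) : ℝ) =
      ∑ i ∈ s, ((i.1 - 1 : ℕ) : ℝ) * Real.log (q i) := by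
    push_cast
    rw [Real.log_prod]
    · simp
    · exact fun i hi => pow_ne_zero _ (by exact_mod_cast (hqp i hi).ne_zero)
  refine ⟨∏ i ∈ s, q i ^ (i.1 - 1), ?_, ?_, ?_, ?_⟩
  · exact prod_ne_zero_iff.2 fun i hi => pow_ne_zero _ (hqp i hi).ne_zero
  · rw [card_divisors_prod_prime_pow s q _ hqp hinj,
      prod_congr rfl fun i hi => Nat.sub_add_cancel (hsP i hi).one_le, prod_sigma]
    simp
  · rw [hlog, hsum, mul_sum]
    refine sum_le_sum fun i hi => ?_
    rw [mul_comm]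
    gcongr
    · exact_mod_cast (hqp i hi).pos
    · exact Nat.le_of_mem_primesLE (hq i hi)
  · rw [hlog, hsum, mul_sum]
    refine sum_le_sum fun i hi => ?_
    rw [mul_comm]
    gcongr
    exact_mod_cast (hqp i hi).two_le

/-- Summation by parts for the sum of the primes up to `y`. -/
theorem sum_primesLE_add_sum_primeCounting (y : ℕ) :
    ∑ p ∈ Nat.primesLE y, p + ∑ t ∈ range y, Nat.primeCounting t =
      y * Nat.primeCounting y := by
  induction y with
  | zero => simp
  | succ y ih =>
    rw [sum_range_succ, ← Nat.primesLE_card_eq_primeCounting (y + 1), Nat.primesLE_succ]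
    split_ifs with h
    · rw [sum_insert (Nat.notMem_primesLE y), card_insert_of_notMem (Nat.notMem_primesLE y),
        Nat.primesLE_card_eq_primeCounting]
      linarith
    · rw [Nat.primesLE_card_eq_primeCounting]
      linarith

theorem primeCounting_mul_log_ge (n : ℕ) :
    n * Real.log 2 - Real.log (n + 1) ≤ Nat.primeCounting n * Real.log n :=
  (Chebyshev.psi_ge n).trans (Chebyshev.psi_le_primeCounting_mul_log n)

theorem sum_primeCounting_mul_log_ge {y Y : ℕ} (h : y ≤ Y) :
    Real.log 2 * (y * (y - 1) / 2) - y * Real.log Y ≤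
      (∑ t ∈ range y, (Nat.primeCounting t : ℝ)) * Real.log Y := by
  have hid : (∑ t ∈ range y, (t : ℝ)) = y * (y - 1) / 2 := by
    clear h
    induction y with
    | zero => simp
    | succ y ih => rw [sum_range_succ, ih]; push_cast; ring
  rw [← hid, mul_sum, sum_mul]
  have hc : (y : ℝ) * Real.log Y = ∑ t ∈ range y, Real.log Y := by simp
  rw [hc, ← sum_sub_distrib]
  refine sum_le_sum fun t ht => ?_
  have htY : t + 1 ≤ Y := (mem_range.1 ht).trans_le h
  have h1 : Real.log (t + 1) ≤ Real.log Y :=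
    Real.log_le_log (by positivity) (by exact_mod_cast htY)
  rcases Nat.eq_zero_or_pos t with rfl | ht0
  · simp
    exact Real.log_natCast_nonneg Y
  have h2 : Real.log t ≤ Real.log Y :=
    Real.log_le_log (by exact_mod_cast ht0) (by exact_mod_cast (Nat.le_succ t).trans htY)
  have h3 := primeCounting_mul_log_ge t
  have h4 := mul_le_mul_of_nonneg_left h2 (Nat.cast_nonneg (α := ℝ) (Nat.primeCounting t))
  linarith

theorem filter_primesLE_two_mul (x : ℕ) :
    (Nat.primesLE (2 * x)).filter (· ≤ x) = Nat.primesLE x := by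
  ext p
  simp only [mem_filter, Nat.mem_primesLE]
  constructor
  · rintro ⟨⟨_, h⟩, h'⟩
    exact ⟨h', h⟩
  · rintro ⟨h, h'⟩
    exact ⟨⟨by omega, h'⟩, h⟩

/-- The number of divisors of the product of `p ^ 3` over the primes `p ≤ x` and of `p` over
the primes `x < p ≤ 2 x`. -/
theorem card_divisors_cube_mul_simple (x : ℕ) :
    (∏ p ∈ Nat.primesLE (2 * x), p ^ (if p ≤ x then 3 else 1)).divisors.card =
      2 ^ (Nat.primeCounting (2 * x) + Nat.primeCounting x) := by
  rw [card_divisors_prod_prime_pow _ (fun p => p) _ (fun p hp => Nat.prime_of_mem_primesLE hp)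
    (fun _ _ _ _ h => h), pow_add]
  have h : ∀ p : ℕ, (if p ≤ x then 3 else 1) + 1 = 2 * (if p ≤ x then 2 else 1) := by
    intro p; split_ifs <;> rfl
  simp_rw [h, prod_mul_distrib]
  rw [prod_ite, filter_primesLE_two_mul]
  simp [Nat.primesLE_card_eq_primeCounting]

theorem sum_cube_mul_simple_le (x : ℕ) :
    ∑ p ∈ Nat.primesLE (2 * x), ((if p ≤ x then 3 else 1 : ℕ) : ℝ) * ((p : ℝ) - 1) ≤
      2 * x * (Nat.primeCounting (2 * x) + Nat.primeCounting x) -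
        (∑ t ∈ range (2 * x), (Nat.primeCounting t : ℝ) +
          2 * ∑ t ∈ range x, (Nat.primeCounting t : ℝ)) := by
  have h1 := congrArg (Nat.cast (R := ℝ)) (sum_primesLE_add_sum_primeCounting (2 * x))
  have h2 := congrArg (Nat.cast (R := ℝ)) (sum_primesLE_add_sum_primeCounting x)
  push_cast at h1 h2
  calc _ ≤ ∑ p ∈ Nat.primesLE (2 * x), ((p : ℝ) + if p ≤ x then 2 * (p : ℝ) else 0) := by
        refine sum_le_sum fun p _ => ?_
        split_ifs <;> push_cast <;> linarith
    _ = ∑ p ∈ Nat.primesLE (2 * x), (p : ℝ) + 2 * ∑ p ∈ Nat.primesLE x, (p : ℝ) := by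
        rw [sum_add_distrib, ← sum_filter, filter_primesLE_two_mul, mul_sum]
    _ ≤ _ := by linarith

theorem mul_self_le_sum_cube_mul_simple (x B : ℕ) (hB : 3 * B ≤ Nat.primeCounting (2 * x)) :
    2 * (B : ℝ) * B ≤
      ∑ p ∈ Nat.primesLE (2 * x), ((if p ≤ x then 3 else 1 : ℕ) : ℝ) * ((p : ℝ) - 1) := by
  rw [← Nat.primesLE_card_eq_primeCounting] at hB
  have hcard : 2 * B ≤ ((Nat.primesLE (2 * x)).filter (B < ·)).card := by
    have h1 := card_filter_add_card_filter_not (s := Nat.primesLE (2 * x)) (B < ·)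
    have h2 : ((Nat.primesLE (2 * x)).filter (¬ B < ·)).card ≤ B := by
      refine (card_le_card (t := Ioc 0 B) fun p hp => ?_).trans (by simp)
      simp only [mem_filter, not_lt] at hp
      exact mem_Ioc.2 ⟨(Nat.prime_of_mem_primesLE hp.1).pos, hp.2⟩
    omega
  calc 2 * (B : ℝ) * B ≤ ∑ p ∈ (Nat.primesLE (2 * x)).filter (B < ·), (B : ℝ) := by
        rw [sum_const, nsmul_eq_mul]
        gcongr
        exact_mod_cast hcard
    _ ≤ ∑ p ∈ (Nat.primesLE (2 * x)).filter (B < ·),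
          ((if p ≤ x then 3 else 1 : ℕ) : ℝ) * ((p : ℝ) - 1) := by
        refine sum_le_sum fun p hp => ?_
        have : (B : ℝ) + 1 ≤ p := by exact_mod_cast (mem_filter.1 hp).2
        have hB0 : (0 : ℝ) ≤ B := Nat.cast_nonneg B
        split_ifs <;> push_cast <;> linarith
    _ ≤ _ := by
        refine sum_le_sum_of_subset_of_nonneg (filter_subset _ _) fun p hp _ => ?_
        have : (1 : ℝ) ≤ p := by exact_mod_cast (Nat.prime_of_mem_primesLE hp).one_le
        exact mul_nonneg (Nat.cast_nonneg _) (by linarith)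

/-- The weight sum is controlled by the number of prime factors, whatever the size of the
prime counting function. -/
theorem sum_cube_mul_simple_le_sq (x : ℕ) (hx : 0 < x)
    (hlog : 2000 * Real.log (2 * x : ℕ) + 2000 ≤ x) :
    2.07 * ∑ p ∈ Nat.primesLE (2 * x), ((if p ≤ x then 3 else 1 : ℕ) : ℝ) * ((p : ℝ) - 1) ≤
      ((Nat.primeCounting (2 * x) : ℝ) + Nat.primeCounting x) ^ 2 * Real.log (2 * x : ℕ) := by
  have hW := sum_cube_mul_simple_le x
  have h1 := sum_primeCounting_mul_log_ge (le_refl (2 * x))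
  have h2 := sum_primeCounting_mul_log_ge (y := x) (Y := 2 * x) (by omega)
  have hl : 0 < Real.log (2 * x : ℕ) := Real.log_pos (by exact_mod_cast (by omega : 1 < 2 * x))
  set W := ∑ p ∈ Nat.primesLE (2 * x), ((if p ≤ x then 3 else 1 : ℕ) : ℝ) * ((p : ℝ) - 1)
  set l := Real.log (2 * x : ℕ)
  set g := (Nat.primeCounting (2 * x) : ℝ) + Nat.primeCounting x
  set T := ∑ t ∈ range (2 * x), (Nat.primeCounting t : ℝ)
  set U := ∑ t ∈ range x, (Nat.primeCounting t : ℝ)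
  have hx' : (0 : ℝ) < x := by exact_mod_cast hx
  push_cast at h1 h2
  have hTU : 2.07 * (x : ℝ) ^ 2 ≤ (T + 2 * U) * l := by
    have h3 : Real.log 2 * (3 * x ^ 2 - 2 * x) - 4 * x * l ≤ (T + 2 * U) * l := by
      linear_combination h1 + 2 * h2
    have h5 : 0.693 * (3 * (x : ℝ) ^ 2 - 2 * x) ≤ Real.log 2 * (3 * x ^ 2 - 2 * x) := by
      have := Real.log_two_gt_d9
      have h1x : (1 : ℝ) ≤ x := by exact_mod_cast hx
      have : 0 ≤ 3 * (x : ℝ) ^ 2 - 2 * x := by nlinarith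
      gcongr
      linarith
    nlinarith
  have hWl : W * l ≤ 2 * x * g * l - 2.07 * (x : ℝ) ^ 2 := by nlinarith
  have hfin : 2.07 * W * l ≤ g ^ 2 * l * l := by
    nlinarith [sq_nonneg (g * l - 2.07 * x)]
  exact le_of_mul_le_mul_right hfin hl

theorem eventually_log_le (c d : ℝ) :
    ∀ᶠ M : ℕ in Filter.atTop, c * Real.log M + d ≤ M := by
  have h1 := (Real.isLittleO_log_id_atTop.const_mul_left c).add
    (Asymptotics.isLittleO_const_id_atTop d)
  have h2 := (h1.bound one_pos).natCast_atTop
  filter_upwards [h2] with M hM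
  have := (le_abs_self _).trans hM
  simpa using this

/-- A weak Chebyshev bound for perfect powers. -/
theorem le_primeCounting_pow (M j : ℕ) (hM : 2 ≤ M) (hj : 1 ≤ j) (hj' : j ≤ 201)
    (hlog : 2000 * Real.log M + 2000 ≤ M) : 3 * M ^ (j - 1) ≤ Nat.primeCounting (M ^ j) := by
  have hM' : (2 : ℝ) ≤ M := by exact_mod_cast hM
  have hl : 0 < Real.log M := Real.log_pos (by linarith)
  have hj1 : (1 : ℝ) ≤ j := by exact_mod_cast hj
  have hj2 : (j : ℝ) ≤ 201 := by exact_mod_cast hj'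
  have h := primeCounting_mul_log_ge (M ^ j)
  push_cast at h
  have hpow : (M : ℝ) ^ j = M ^ (j - 1) * M := by
    rw [← pow_succ, Nat.sub_add_cancel hj]
  have hA : (1 : ℝ) ≤ (M : ℝ) ^ (j - 1) := one_le_pow₀ (by linarith)
  have hlog1 : Real.log ((M : ℝ) ^ j + 1) ≤ Real.log 2 + j * Real.log M := by
    rw [← Real.log_pow, ← Real.log_mul (by norm_num) (by positivity)]
    refine Real.log_le_log (by positivity) ?_
    have : (1 : ℝ) ≤ (M : ℝ) ^ j := one_le_pow₀ (by linarith)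
    linarith
  rw [Real.log_pow] at h
  have g1 := Real.log_two_gt_d9
  have g2 := Real.log_two_lt_d9
  by_contra! hcon
  have hcon' : (Nat.primeCounting (M ^ j) : ℝ) ≤ 3 * (M : ℝ) ^ (j - 1) := by
    exact_mod_cast hcon.le
  set A := (M : ℝ) ^ (j - 1)
  set L := Real.log M
  have hjl : (j : ℝ) * L ≤ 201 * L := by gcongr
  have hjl0 : 0 ≤ (j : ℝ) * L := by positivity
  have e1 : (Nat.primeCounting (M ^ j) : ℝ) * (j * L) ≤ 3 * A * (201 * L) := by gcongr
  have e2 : A * M * 0.69 ≤ A * M * Real.log 2 := by gcongr; linarith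
  have e3 : A * (2000 * L + 2000) ≤ A * M := by gcongr
  have e4 : 1 * (201 * L + 1) ≤ A * (201 * L + 1) := by gcongr
  rw [hpow] at h hlog1
  nlinarith [mul_pos (lt_of_lt_of_le one_pos hA) hl]

theorem ramanujan_iterated_divisor_lower_bound :
    ∀ N : ℕ, ∃ n : ℕ, N < n ∧
      ((n.divisors.card).divisors.card : ℝ) >
        (4 : ℝ) ^ (Real.sqrt (2 * Real.log n) / Real.log (Real.log n)) := by
  intro N
  obtain ⟨M, ⟨hMlog, hMN⟩, hMeven⟩ : ∃ M : ℕ, (400000 * Real.log M + 400000 ≤ M ∧ N + 2 ≤ M) ∧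
      Even M := by
    have h := (eventually_log_le 400000 400000).and (Filter.eventually_ge_atTop (N + 2))
    obtain ⟨a, ha⟩ := Filter.eventually_atTop.1 h
    exact ⟨2 * a, ha _ (by omega), even_two_mul a⟩
  have hM2 : (2 : ℝ) ≤ M := by exact_mod_cast (by omega : 2 ≤ M)
  have hL : 0 < Real.log M := Real.log_pos (by linarith)
  obtain ⟨x, hx⟩ : ∃ x, M ^ 200 = 2 * x :=
    even_iff_exists_two_mul.1 (hMeven.pow_of_ne_zero (by norm_num))
  have hMx : M ≤ x := by
    have h1 : M ^ 2 ≤ M ^ 200 := Nat.pow_le_pow_right (by omega) (by norm_num)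
    have h2 : 2 * M ≤ M ^ 2 := by nlinarith
    omega
  have hMx' : (M : ℝ) ≤ x := by exact_mod_cast hMx
  have hl : Real.log (2 * x : ℕ) = 200 * Real.log M := by
    rw [← hx]; push_cast; rw [Real.log_pow]; norm_num
  have hW := sum_cube_mul_simple_le_sq x (by omega) (by rw [hl]; linarith)
  have hπ := le_primeCounting_pow M 200 (by omega) (by norm_num) (by norm_num) (by linarith)
  have hz := le_primeCounting_pow M 201 (by omega) (by norm_num) (by norm_num) (by linarith)
  rw [hx] at hπ
  have hW' := mul_self_le_sum_cube_mul_simple x (M ^ 199) hπ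
  obtain ⟨n, hn0, hn, hle, hge⟩ := exists_card_divisors_eq_prod_pow (Nat.primesLE (2 * x))
    (fun p hp => Nat.prime_of_mem_primesLE hp) (fun p => if p ≤ x then 3 else 1) (M ^ 201) (by
      refine le_trans ?_ hz
      rw [show 201 - 1 = 200 from rfl, hx]
      calc _ ≤ ∑ p ∈ Nat.primesLE (2 * x), 3 := sum_le_sum fun p _ => by split_ifs <;> simp
        _ = 3 * Nat.primeCounting (2 * x) := by
          rw [sum_const, Nat.primesLE_card_eq_primeCounting, smul_eq_mul, mul_comm]
        _ ≤ _ := by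
          gcongr
          rw [← Nat.primesLE_card_eq_primeCounting]
          refine (card_le_card (t := Ioc 0 (2 * x)) fun p hp => ?_).trans (by simp)
          exact mem_Ioc.2 ⟨(Nat.prime_of_mem_primesLE hp).pos, Nat.le_of_mem_primesLE hp⟩)
  rw [hl] at hW
  set W := ∑ p ∈ Nat.primesLE (2 * x), ((if p ≤ x then 3 else 1 : ℕ) : ℝ) * ((p : ℝ) - 1)
  set g : ℕ := Nat.primeCounting (2 * x) + Nat.primeCounting x with hg
  have hgpos : (0 : ℝ) < g := by
    have : 0 < M ^ (200 - 1) := pow_pos (by omega) _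
    exact_mod_cast (by omega : 0 < g)
  have hlz : Real.log (M ^ 201 : ℕ) = 201 * Real.log M := by
    push_cast; rw [Real.log_pow]; norm_num
  rw [hlz] at hle
  set L := Real.log M with hLdef
  have hlow : (M : ℝ) ^ 398 ≤ Real.log n := by
    refine le_trans ?_ hge
    have h2 := Real.log_two_gt_d9
    push_cast at hW'
    have h3 : (M : ℝ) ^ 398 = M ^ 199 * M ^ 199 := by rw [← pow_add]
    rw [h3]
    have h4 : 0 ≤ (M : ℝ) ^ 199 * M ^ 199 := by positivity
    set Q := (M : ℝ) ^ 199 * M ^ 199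
    have h5 : 2 * Q ≤ W := by linarith [mul_assoc (2 : ℝ) ((M : ℝ) ^ 199) ((M : ℝ) ^ 199)]
    nlinarith
  have hMpow : (M : ℝ) ≤ (M : ℝ) ^ 398 := le_self_pow₀ (by linarith) (by norm_num)
  have hloglog : 398 * L ≤ Real.log (Real.log n) := by
    have := Real.log_le_log (pow_pos (by linarith) _) hlow
    rwa [Real.log_pow] at this
  refine ⟨n, ?_, ?_⟩
  · have h1 := Real.log_le_self (Nat.cast_nonneg (α := ℝ) n)
    have h2 : (M : ℝ) ≤ n := by linarith
    have h3 : M ≤ n := by exact_mod_cast h2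
    omega
  · rw [hn, card_divisors_cube_mul_simple]
    have hsq : Real.sqrt (2 * Real.log n) ≤ 0.99 * g * (200 * L) := by
      rw [Real.sqrt_le_left (by positivity)]
      have hgc : (g : ℝ) = Nat.primeCounting (2 * x) + Nat.primeCounting x := by
        rw [hg]; push_cast; rfl
      rw [← hgc] at hW
      have h1 := mul_le_mul_of_nonneg_right hW hL.le
      have h2 : 0 ≤ (g : ℝ) ^ 2 * L ^ 2 := by positivity
      nlinarith
    have hexp : Real.sqrt (2 * Real.log n) / Real.log (Real.log n) < g / 2 := by
      rw [div_lt_iff₀ (by linarith)]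
      have h1 : (g : ℝ) / 2 * (398 * L) ≤ g / 2 * Real.log (Real.log n) := by gcongr
      have h2 : 0 < (g : ℝ) * L := by positivity
      nlinarith
    calc (4 : ℝ) ^ (Real.sqrt (2 * Real.log n) / Real.log (Real.log n))
        < (4 : ℝ) ^ ((g : ℝ) / 2) := Real.rpow_lt_rpow_of_exponent_lt (by norm_num) hexp
      _ = ((2 ^ g : ℕ) : ℝ) := by
        rw [show (4 : ℝ) = 2 ^ (2 : ℝ) by norm_num, ← Real.rpow_mul (by norm_num),
          mul_div_cancel₀ _ (by norm_num), Real.rpow_natCast]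
        push_cast; rfl
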